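/- arXiv:0906.3337 — 2 statements merged into one kernel-verified Lean document; each statement's English description precedes it below -/
import Mathlib

section
/- Let V : ℤ → ℝ be periodic with period p ≥ 1. Then the spectrum σ(H) of the Schrödinger operator H with potential V can be written as a union of p closed intervals, each of which has Lebesgue measure at most 2π/p. -/
open Polynomial

/-- The one-step transfer matrix at site `n` and energy `x`. -/
def transferStep {R : Type*} [CommRing R] (x : R) (V : ℤ → R) (n : ℤ) :
    Matrix (Fin 2) (Fin 2) R :=
  !![x - V n, -1; 1, 0]

/-- The transfer matrix across the `k` sites `m, …, m + k - 1`. -/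
def transfer {R : Type*} [CommRing R] (x : R) (V : ℤ → R) (m : ℤ) :
    ℕ → Matrix (Fin 2) (Fin 2) R
  | 0 => 1
  | k + 1 => transferStep x V (m + k) * transfer x V m k

section Transfer

variable {R : Type*} [CommRing R] (x : R) (V : ℤ → R)

theorem transfer_zero (m : ℤ) : transfer x V m 0 = 1 := rfl

theorem transfer_succ (m : ℤ) (k : ℕ) :
    transfer x V m (k + 1) = transferStep x V (m + k) * transfer x V m k := rfl

theorem transfer_add (m : ℤ) (j k : ℕ) :
    transfer x V m (j + k) = transfer x V (m + j) k * transfer x V m j := by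
  induction k with
  | zero => simp [transfer_zero]
  | succ k ih =>
    rw [← add_assoc, transfer_succ, transfer_succ, ih, Matrix.mul_assoc]
    push_cast
    rw [add_assoc]

theorem det_transfer (m : ℤ) (k : ℕ) : (transfer x V m k).det = 1 := by
  induction k with
  | zero => simp [transfer_zero]
  | succ k ih => rw [transfer_succ, Matrix.det_mul, ih]; simp [transferStep, Matrix.det_fin_two]

theorem map_transfer {S : Type*} [CommRing S] (f : R →+* S) (m : ℤ) (k : ℕ) :
    (transfer x V m k).map f = transfer (f x) (fun n => f (V n)) m k := by
  induction k with
  | zero => simp [transfer_zero]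
  | succ k ih =>
    rw [transfer_succ, Matrix.map_mul, ih, transfer_succ]
    congr 1
    ext i j
    fin_cases i <;> fin_cases j <;> simp [transferStep]

theorem transfer_periodic {V : ℤ → R} {p : ℕ} (hV : ∀ n : ℤ, V (n + p) = V n) (m : ℤ) (k : ℕ) :
    transfer x V (m + p) k = transfer x V m k := by
  induction k with
  | zero => rfl
  | succ k ih =>
    rw [transfer_succ, transfer_succ, ih, transferStep, transferStep,
      show m + p + k = m + k + (p : ℤ) by ring, hV]

theorem transfer_conj {V : ℤ → R} {p : ℕ} (hV : ∀ n : ℤ, V (n + p) = V n) (m : ℤ) :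
    transfer x V (m + 1) p * transferStep x V m = transferStep x V m * transfer x V m p := by
  have h1 := transfer_add x V m 1 p
  have h2 := transfer_succ x V m p
  rw [add_comm 1 p, h2] at h1
  simp only [transfer_succ x V m 0, transfer_zero, Nat.cast_one, Nat.cast_zero, add_zero,
    mul_one] at h1
  rw [← h1, transferStep, transferStep, hV]

theorem transfer_conj_entries {V : ℤ → R} {p : ℕ} (hV : ∀ n : ℤ, V (n + p) = V n) (m : ℤ) :
    transfer x V (m + 1) p 1 0 = - transfer x V m p 0 1 ∧
      (transfer x V (m + 1) p).trace = (transfer x V m p).trace := by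
  have h := transfer_conj x hV m
  have h01 := congrFun (congrFun h 0) 1
  have h10 := congrFun (congrFun h 1) 0
  have h11 := congrFun (congrFun h 1) 1
  simp only [transferStep, Matrix.mul_apply, Fin.sum_univ_two, Matrix.of_apply, Matrix.cons_val',
    Matrix.cons_val_zero, Matrix.cons_val_one, Matrix.cons_val_fin_one] at h01 h10 h11
  refine ⟨by linear_combination -h11, ?_⟩
  rw [Matrix.trace_fin_two, Matrix.trace_fin_two]
  linear_combination -h01 + h10 + (x - V m) * h11

theorem trace_transfer {V : ℤ → R} {p : ℕ} (hV : ∀ n : ℤ, V (n + p) = V n) (m : ℤ) :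
    (transfer x V m p).trace = (transfer x V 0 p).trace := by
  induction m using Int.induction_on with
  | zero => rfl
  | succ i ih => rw [← ih, (transfer_conj_entries x hV _).2]
  | pred i ih =>
    rw [← ih]
    have := (transfer_conj_entries x hV (-(i : ℤ) - 1)).2
    rw [← this, sub_add_cancel]

/-- The transfer matrix propagates solutions; a solution is given as a sequence of additive maps
so that the scalars may be an arbitrary commutative ring acting on it. -/
theorem transfer_propagates {N : Type*} [AddCommGroup N] (φ : ℤ → R →+ N) (m : ℤ) (k : ℕ)
    (hφ : ∀ j : ℕ, j < k → ∀ q, φ (m + j + 1) q = φ (m + j) ((x - V (m + j)) * q)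
      - φ (m + j - 1) q) (q : R) :
    φ (m + k) q = φ m (transfer x V m k 0 0 * q) + φ (m - 1) (transfer x V m k 0 1 * q) ∧
      φ (m + k - 1) q
        = φ m (transfer x V m k 1 0 * q) + φ (m - 1) (transfer x V m k 1 1 * q) := by
  induction k generalizing q with
  | zero => simp [transfer_zero]
  | succ k ih =>
    have ih' := ih (fun j hj => hφ j (by omega))
    push_cast
    rw [← add_assoc, hφ k (by omega), add_sub_cancel_right, (ih' _).1, (ih' _).1, (ih' _).2]
    simp only [transfer_succ, transferStep, Matrix.mul_apply, Fin.sum_univ_two, Matrix.of_apply,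
      Matrix.cons_val', Matrix.cons_val_zero, Matrix.cons_val_one, Matrix.cons_val_fin_one,
      zero_mul, add_zero, one_mul, and_true, add_mul, map_add, neg_mul, map_neg]
    simp only [mul_assoc, mul_left_comm _ (x - V (m + k)) q]
    abel

theorem transfer_two_periods {V : ℤ → R} {p : ℕ} (hV : ∀ n : ℤ, V (n + p) = V n)
    {N : Type*} [AddCommGroup N] (φ : ℤ → R →+ N) (m : ℤ)
    (hφ : ∀ j : ℕ, j < 2 * p → ∀ q, φ (m + j + 1) q = φ (m + j) ((x - V (m + j)) * q)
      - φ (m + j - 1) q) (q : R) :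
    φ (m + 2 * p) q + φ m q = φ (m + p) ((transfer x V 0 p).trace * q) := by
  have h1 := transfer_propagates x V φ m p (fun j hj => hφ j (by omega))
  have h2 := transfer_propagates x V φ (m + p) p
    (fun j hj q => by
      have := hφ (p + j) (by omega) q
      push_cast at this
      simpa only [add_assoc] using this) q
  have hd := det_transfer x V m p
  rw [Matrix.det_fin_two] at hd
  rw [← trace_transfer x hV m, Matrix.trace_fin_two, show m + 2 * (p : ℤ) = m + p + p by ring,
    h2.1, transfer_periodic x hV, (h1 _).2, add_mul, map_add, (h1 (_ * q)).1, (h1 (_ * q)).1]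
  set a := transfer x V m p 0 0
  set b := transfer x V m p 0 1
  set c := transfer x V m p 1 0
  set d := transfer x V m p 1 1
  have e1 : φ m q = φ m (a * (d * q)) - φ m (c * (b * q)) := by
    rw [← map_sub]
    congr 1
    linear_combination -q * hd
  rw [e1, (by ring : b * (d * q) = d * (b * q))]
  abel

end Transfer

/-- The discriminant of a potential over `p` sites, as a polynomial in the energy. -/
noncomputable def discriminant (V : ℤ → ℝ) (p : ℕ) : ℝ[X] :=
  (transfer X (fun n => C (V n)) 0 p).trace

theorem aeval_discriminant {A : Type*} [CommRing A] [Algebra ℝ A] (V : ℤ → ℝ) (p : ℕ) (z : A) :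
    aeval z (discriminant V p) = (transfer z (fun n => algebraMap ℝ A (V n)) 0 p).trace := by
  have h := map_transfer X (fun n => C (V n)) (aeval z : ℝ[X] →ₐ[ℝ] A).toRingHom 0 p
  simp only [AlgHom.toRingHom_eq_coe, RingHom.coe_coe, aeval_X, aeval_C] at h
  rw [← h, discriminant, Matrix.trace_fin_two, Matrix.trace_fin_two, map_add]
  rfl

theorem eval_discriminant (V : ℤ → ℝ) (p : ℕ) (x : ℝ) :
    (discriminant V p).eval x = (transfer x V 0 p).trace := by
  rw [← coe_aeval_eq_eval, aeval_discriminant]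
  rfl

theorem degree_transfer (V : ℤ → ℝ) (m : ℤ) (k : ℕ) :
    ((transfer X (fun n => C (V n)) m k 0 0).Monic ∧
      (transfer X (fun n => C (V n)) m k 0 0).natDegree = k) ∧
    (transfer X (fun n => C (V n)) m k 0 1).degree < k ∧
    (transfer X (fun n => C (V n)) m k 1 0).degree < k ∧
    (transfer X (fun n => C (V n)) m k 1 1).degree < (k + 1 : ℕ) ∧
    (0 < k → (transfer X (fun n => C (V n)) m k 1 1).degree < k) := by
  induction k with
  | zero => simp [transfer_zero]
  | succ k ih =>
    simp only [transfer_succ, transferStep, Matrix.mul_apply, Fin.sum_univ_two, Matrix.of_apply,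
      Matrix.cons_val', Matrix.cons_val_zero, Matrix.cons_val_one, Matrix.cons_val_fin_one,
      zero_mul, add_zero, one_mul, neg_mul, ← sub_eq_add_neg]
    obtain ⟨⟨hm, hd⟩, h01, h10, h11, -⟩ := ih
    set a := transfer X (fun n => C (V n)) m k 0 0
    set b := transfer X (fun n => C (V n)) m k 0 1
    set c := transfer X (fun n => C (V n)) m k 1 0
    set d := transfer X (fun n => C (V n)) m k 1 1
    have hk : ((k : ℕ) : WithBot ℕ) < (k + 1 : ℕ) := by exact_mod_cast Nat.lt_succ_self k
    have hk2 : ((k : ℕ) : WithBot ℕ) < (k + 1 + 1 : ℕ) := by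
      exact_mod_cast Nat.lt_succ_of_lt (Nat.lt_succ_self k)
    have hma : ((X - C (V (m + k))) * a).Monic := (monic_X_sub_C _).mul hm
    have hda : ((X - C (V (m + k))) * a).natDegree = k + 1 := by
      rw [(monic_X_sub_C _).natDegree_mul hm, natDegree_X_sub_C, hd, add_comm]
    have hda' : ((X - C (V (m + k))) * a).degree = ((k + 1 : ℕ) : WithBot ℕ) := by
      rw [degree_eq_natDegree hma.ne_zero, hda]
    have hlt : c.degree < ((X - C (V (m + k))) * a).degree := hda' ▸ h10.trans hk
    have hda0 : a.degree < (k + 1 : ℕ) := by rwa [degree_eq_natDegree hm.ne_zero, hd]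
    refine ⟨⟨hma.sub_of_left hlt, ?_⟩, ?_, hda0, h01.trans hk2, fun _ => h01.trans hk⟩
    · rw [natDegree_eq_of_degree_eq (degree_sub_eq_left_of_degree_lt hlt), hda]
    · refine (degree_sub_le _ _).trans_lt (max_lt ?_ h11)
      rw [degree_mul, degree_X_sub_C]
      by_cases hb : b = 0
      · simp [hb]
      · rw [degree_eq_natDegree hb] at h01 ⊢
        have : b.natDegree < k := by exact_mod_cast h01
        exact_mod_cast (by omega : 1 + b.natDegree < k + 1)

theorem discriminant_monic (V : ℤ → ℝ) {p : ℕ} (hp : 1 ≤ p) :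
    (discriminant V p).Monic ∧ (discriminant V p).natDegree = p := by
  obtain ⟨⟨hm, hd⟩, -, -, -, h11⟩ := degree_transfer V 0 p
  rw [discriminant, Matrix.trace_fin_two]
  have hlt : (transfer X (fun n => C (V n)) 0 p 1 1).degree
      < (transfer X (fun n => C (V n)) 0 p 0 0).degree := by
    rw [degree_eq_natDegree hm.ne_zero, hd]
    exact h11 hp
  exact ⟨hm.add_of_left hlt, by
    rw [natDegree_eq_of_degree_eq (degree_add_eq_left_of_degree_lt hlt), hd]⟩

theorem matrix_map_derivative_mul (A B : Matrix (Fin 2) (Fin 2) ℝ[X]) :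
    (A * B).map derivative = A.map derivative * B + A * B.map derivative := by
  ext i j : 1
  simp only [Matrix.map_apply, Matrix.mul_apply, Fin.sum_univ_two, Matrix.add_apply,
    derivative_add, derivative_mul]
  ring

theorem derivative_transfer (V : ℤ → ℝ) (m : ℤ) (k : ℕ) :
    (transfer X (fun n => C (V n)) m k).map derivative =
      ∑ j ∈ Finset.range k, transfer X (fun n => C (V n)) (m + (j + 1 : ℕ)) (k - 1 - j) *
        !![1, 0; 0, 0] * transfer X (fun n => C (V n)) m j := by
  induction k with
  | zero =>
    ext i j : 1
    fin_cases i <;> fin_cases j <;> simp [transfer_zero]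
  | succ k ih =>
    have hstep : (transferStep (X : ℝ[X]) (fun n => C (V n)) (m + k)).map derivative
        = !![1, 0; 0, 0] := by
      ext i j : 1
      fin_cases i <;> fin_cases j <;> simp [transferStep]
    rw [transfer_succ, matrix_map_derivative_mul, ih, hstep, Finset.sum_range_succ, Finset.mul_sum]
    refine (add_comm _ _).trans (congrArg₂ (· + ·) ?_ ?_)
    · refine Finset.sum_congr rfl fun j hj => ?_
      have hj := Finset.mem_range.1 hj
      rw [show k + 1 - 1 - j = (k - 1 - j) + 1 by omega, transfer_succ,
        show m + ((j + 1 : ℕ) : ℤ) + ((k - 1 - j : ℕ) : ℤ) = m + k by omega]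
      simp only [Matrix.mul_assoc]
    · simp [transfer_zero]

theorem derivative_discriminant {V : ℤ → ℝ} {p : ℕ} (hV : ∀ n : ℤ, V (n + p) = V n) :
    derivative (discriminant V p)
      = ∑ j ∈ Finset.range p, transfer X (fun n => C (V n)) (j + 1 : ℕ) p 1 0 := by
  have hV' : ∀ n : ℤ, (fun n => C (V n)) (n + p) = (fun n => C (V n)) n := fun n => by simp [hV]
  have h := congrArg Matrix.trace (derivative_transfer V 0 p)
  rw [Matrix.trace_sum] at h
  have h0 : derivative (discriminant V p)
      = ((transfer X (fun n => C (V n)) 0 p).map derivative).trace := by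
    rw [discriminant, Matrix.trace_fin_two, Matrix.trace_fin_two, derivative_add]
    rfl
  rw [h0, h]
  refine Finset.sum_congr rfl fun j hj => ?_
  have hj := Finset.mem_range.1 hj
  obtain ⟨q, rfl⟩ : ∃ q, p = q + 1 := ⟨p - 1, by omega⟩
  have e : transfer (X : ℝ[X]) (fun n => C (V n)) ((j + 1 : ℕ) : ℤ) q
      = transfer X (fun n => C (V n)) 0 j
        * transfer X (fun n => C (V n)) ((j + 1 : ℕ) : ℤ) (q - j) := by
    have hper := transfer_periodic (X : ℝ[X]) (V := fun n => C (V n)) hV' 0 j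
    have := transfer_add (X : ℝ[X]) (fun n => C (V n)) ((j + 1 : ℕ) : ℤ) (q - j) j
    rw [show q - j + j = q by omega, show ((j + 1 : ℕ) : ℤ) + ((q - j : ℕ) : ℤ)
      = 0 + ((q + 1 : ℕ) : ℤ) by omega, hper] at this
    exact this
  rw [Matrix.mul_assoc, Matrix.trace_mul_comm, Matrix.mul_assoc, zero_add,
    show q + 1 - 1 - j = q - j by omega, ← e, transfer_succ]
  generalize transfer (X : ℝ[X]) (fun n => C (V n)) ((j + 1 : ℕ) : ℤ) q = A
  simp only [Matrix.trace_fin_two, transferStep, Matrix.mul_apply, Fin.sum_univ_two,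
    Matrix.of_apply, Matrix.cons_val', Matrix.cons_val_zero, Matrix.cons_val_one,
    Matrix.cons_val_fin_one]
  ring

theorem abs_derivative_discriminant {V : ℤ → ℝ} {p : ℕ} (hV : ∀ n : ℤ, V (n + p) = V n) {x : ℝ}
    (hx : |(discriminant V p).eval x| < 2) :
    p * √(1 - ((discriminant V p).eval x / 2) ^ 2)
      ≤ |(derivative (discriminant V p)).eval x| := by
  set t := (discriminant V p).eval x with ht
  set c : ℕ → ℝ := fun j => transfer x V j p 1 0 with hc
  have hsum : (derivative (discriminant V p)).eval x = ∑ j ∈ Finset.range p, c (j + 1) := by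
    rw [derivative_discriminant hV, eval_finsetSum]
    refine Finset.sum_congr rfl fun j _ => ?_
    have h := map_transfer X (fun n => C (V n)) (evalRingHom x) (j + 1 : ℕ) p
    simp only [coe_evalRingHom, eval_X, eval_C] at h
    rw [hc]
    simp only
    rw [← h]
    rfl
  set s := √(1 - (t / 2) ^ 2) with hs
  have hpos : 0 < 1 - (t / 2) ^ 2 := by
    have := abs_lt.1 hx
    nlinarith
  have hs2 : s ^ 2 = 1 - (t / 2) ^ 2 := Real.sq_sqrt hpos.le
  have hmul : ∀ j, s ^ 2 ≤ c j * c (j + 1) := by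
    intro j
    have hdet := det_transfer x V j p
    have htr := trace_transfer x hV (j : ℤ)
    rw [← eval_discriminant, ← ht, Matrix.trace_fin_two] at htr
    rw [Matrix.det_fin_two] at hdet
    have := (transfer_conj_entries x hV (j : ℤ)).1
    simp only [hc]
    push_cast
    rw [this, hs2, ← htr]
    nlinarith [sq_nonneg (transfer x V j p 0 0 - transfer x V j p 1 1)]
  have hperiod : c p = c 0 := by
    have := transfer_periodic x hV 0 p
    simp only [hc, Nat.cast_zero]
    rw [← this, zero_add]
  have hspos : 0 < s := Real.sqrt_pos.2 hpos
  have habs : |∑ j ∈ Finset.range p, c (j + 1)| = ∑ j ∈ Finset.range p, |c (j + 1)| := by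
    rcases le_total 0 (c 0) with h0 | h0
    · have : ∀ j, 0 ≤ c j := by
        intro j
        induction j with
        | zero => exact h0
        | succ j ih => nlinarith [hmul j, sq_pos_of_pos hspos]
      rw [abs_of_nonneg (Finset.sum_nonneg fun j _ => this _)]
      exact Finset.sum_congr rfl fun j _ => (abs_of_nonneg (this _)).symm
    · have : ∀ j, c j ≤ 0 := by
        intro j
        induction j with
        | zero => exact h0
        | succ j ih => nlinarith [hmul j, sq_pos_of_pos hspos]
      rw [abs_of_nonpos (Finset.sum_nonpos fun j _ => this _), ← Finset.sum_neg_distrib]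
      exact Finset.sum_congr rfl fun j _ => (abs_of_nonpos (this _)).symm
  have hshift : ∑ j ∈ Finset.range p, |c (j + 1)| = ∑ j ∈ Finset.range p, |c j| := by
    have h1 := Finset.sum_range_succ (fun j => |c j|) p
    have h2 := Finset.sum_range_succ' (fun j => |c j|) p
    rw [hperiod] at h1
    linarith
  have hamgm : ∀ j, 2 * s ≤ |c j| + |c (j + 1)| := by
    intro j
    have h1 : s ^ 2 ≤ |c j| * |c (j + 1)| := by
      rw [← abs_mul]
      exact (hmul j).trans (le_abs_self _)
    refine le_of_sq_le_sq ?_ (by positivity)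
    nlinarith [sq_nonneg (|c j| - |c (j + 1)|)]
  have htotal : ∑ _j ∈ Finset.range p, 2 * s ≤ ∑ j ∈ Finset.range p, (|c j| + |c (j + 1)|) :=
    Finset.sum_le_sum fun j _ => hamgm j
  rw [Finset.sum_add_distrib, Finset.sum_const, Finset.card_range, nsmul_eq_mul] at htotal
  rw [hsum, habs]
  linarith

theorem lp_hasSum_sq (ψ : lp (fun _ : ℤ => ℝ) 2) : HasSum (fun n => ψ n ^ 2) (‖ψ‖ ^ 2) := by
  have h := lp.hasSum_norm (p := 2) (by norm_num) ψ
  simpa using h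

theorem lp_tendsto_cofinite (ψ : lp (fun _ : ℤ => ℝ) 2) :
    Filter.Tendsto ψ Filter.cofinite (nhds 0) := by
  have h := (lp_hasSum_sq ψ).summable.tendsto_cofinite_zero
  rw [tendsto_zero_iff_abs_tendsto_zero]
  have h2 := (Real.continuous_sqrt.tendsto 0).comp h
  simpa [Function.comp_def, Real.sqrt_sq_eq_abs] using h2

section Operator

variable {p : ℕ} {V : ℤ → ℝ} {H : lp (fun _ : ℤ => ℝ) 2 →L[ℝ] lp (fun _ : ℤ => ℝ) 2}

/-- The discriminant of a periodic Schrödinger operator, evaluated at the operator itself, is the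
sum of the two translations by the period. -/
theorem aeval_discriminant_apply (hV : ∀ n : ℤ, V (n + p) = V n)
    (hH : ∀ ψ : lp (fun _ : ℤ => ℝ) 2, ∀ n : ℤ,
        H ψ n = ψ (n + 1) + ψ (n - 1) + V n * ψ n)
    (ψ : lp (fun _ : ℤ => ℝ) 2) (n : ℤ) :
    aeval H (discriminant V p) ψ n = ψ (n + p) + ψ (n - p) := by
  let φ : ℤ → ℝ[X] →+ ℝ := fun n => AddMonoidHom.mk' (fun q => aeval H q ψ n) fun q r => by
    simp only [map_add, add_apply, lp.coeFn_add, Pi.add_apply]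
  have hφ : ∀ n q, φ n q = aeval H q ψ n := fun _ _ => rfl
  have hV' : ∀ n : ℤ, (fun n => C (V n)) (n + p) = (fun n => C (V n)) n := fun n => by simp [hV]
  have h := transfer_two_periods X (V := fun n => C (V n)) hV' φ (n - p) (fun j _ q => by
    have e : aeval H ((X - C (V (n - p + j))) * q) ψ
        = H (aeval H q ψ) - V (n - p + j) • aeval H q ψ := by
      rw [map_mul, map_sub, aeval_X, aeval_C]
      rfl
    simp only [hφ]
    rw [e, lp.coeFn_sub, Pi.sub_apply, hH, lp.coeFn_smul, Pi.smul_apply, smul_eq_mul]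
    ring) 1
  rw [show n - p + 2 * (p : ℤ) = n + p by ring, show n - p + (p : ℤ) = n by ring, mul_one] at h
  simp only [hφ, map_one, one_apply_eq_self] at h
  exact h.symm

theorem abs_discriminant_le_of_mem_spectrum (hV : ∀ n : ℤ, V (n + p) = V n)
    (hH : ∀ ψ : lp (fun _ : ℤ => ℝ) 2, ∀ n : ℤ,
        H ψ n = ψ (n + 1) + ψ (n - 1) + V n * ψ n)
    {x : ℝ} (hx : x ∈ spectrum ℝ H) : |(discriminant V p).eval x| ≤ 2 := by
  have hmem : (discriminant V p).eval x ∈ spectrum ℝ (aeval H (discriminant V p)) :=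
    spectrum.subset_polynomial_aeval H _ ⟨x, hx, rfl⟩
  have hnorm : ‖aeval H (discriminant V p)‖ ≤ 2 := by
    refine ContinuousLinearMap.opNorm_le_bound _ zero_le_two fun ψ => ?_
    have hsum := lp_hasSum_sq ψ
    have hp := (Equiv.addRight (p : ℤ)).hasSum_iff.2 hsum
    have hm := (Equiv.subRight (p : ℤ)).hasSum_iff.2 hsum
    have hle := hasSum_le (fun n => ?_) (lp_hasSum_sq (aeval H (discriminant V p) ψ))
      ((hp.add hm).mul_left 2)
    · refine le_of_sq_le_sq ?_ (by positivity)
      linarith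
    · simp only [Function.comp_apply, Equiv.coe_addRight, Equiv.subRight_apply]
      rw [aeval_discriminant_apply hV hH]
      nlinarith [sq_nonneg (ψ (n + p) - ψ (n - p))]
  calc |(discriminant V p).eval x|
      ≤ ‖aeval H (discriminant V p)‖
        * ‖(1 : lp (fun _ : ℤ => ℝ) 2 →L[ℝ] lp (fun _ : ℤ => ℝ) 2)‖ :=
        spectrum.norm_le_norm_mul_of_mem hmem
    _ ≤ 2 * 1 := mul_le_mul hnorm ContinuousLinearMap.norm_id_le (norm_nonneg _) zero_le_two
    _ = 2 := mul_one 2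

theorem eq_zero_of_recurrence_of_tendsto_zero {t : ℝ} (ht : |t| ≤ 2) {g : ℕ → ℝ}
    (hg : ∀ k, g (k + 2) + g k = t * g (k + 1)) (hlim : Filter.Tendsto g Filter.atTop (nhds 0)) :
    g 0 = 0 := by
  have hlim1 : Filter.Tendsto (fun k => g (k + 1)) Filter.atTop (nhds 0) :=
    (Filter.tendsto_add_atTop_iff_nat 1).2 hlim
  have hconst : ∀ k, g (k + 1) ^ 2 - t * g (k + 1) * g k + g k ^ 2
      = g 1 ^ 2 - t * g 1 * g 0 + g 0 ^ 2 := by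
    intro k
    induction k with
    | zero => rfl
    | succ k ih =>
      rw [← ih]
      linear_combination (g (k + 2) - g k) * hg k
  have hQ : g 1 ^ 2 - t * g 1 * g 0 + g 0 ^ 2 = 0 := by
    have h1 : Filter.Tendsto (fun k => g (k + 1) ^ 2 - t * g (k + 1) * g k + g k ^ 2)
        Filter.atTop (nhds 0) := by
      simpa using ((hlim1.pow 2).sub ((hlim1.const_mul t).mul hlim)).add (hlim.pow 2)
    simp only [hconst] at h1
    exact tendsto_nhds_unique tendsto_const_nhds h1
  have habs : ∀ k, |g k| = |g 0| := by
    intro k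
    induction k with
    | zero => rfl
    | succ k ih =>
      have hk := (hconst k).trans hQ
      rw [← ih]
      have h1 : t * g (k + 1) * g k ≤ 2 * (|g (k + 1)| * |g k|) := by
        refine (le_abs_self _).trans ?_
        rw [abs_mul, abs_mul, mul_assoc]
        gcongr
      have h2 : (|g (k + 1)| - |g k|) ^ 2 ≤ 0 := by
        nlinarith [sq_abs (g (k + 1)), sq_abs (g k)]
      have h3 := pow_eq_zero_iff (two_ne_zero) |>.1 (le_antisymm h2 (sq_nonneg _))
      linarith
  have hl := hlim.abs
  simp only [habs, abs_zero] at hl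
  exact abs_eq_zero.1 (tendsto_nhds_unique tendsto_const_nhds hl)

theorem mem_spectrum_of_abs_discriminant_le (hp : 1 ≤ p) (hV : ∀ n : ℤ, V (n + p) = V n)
    (hH : ∀ ψ : lp (fun _ : ℤ => ℝ) 2, ∀ n : ℤ,
        H ψ n = ψ (n + 1) + ψ (n - 1) + V n * ψ n)
    {x : ℝ} (hx : |(discriminant V p).eval x| ≤ 2) : x ∈ spectrum ℝ H := by
  intro hunit
  obtain ⟨B, hB, -⟩ := isUnit_iff_exists.1 hunit
  set f := B (lp.single 2 0 1) with hf
  have hrec : ∀ n, x * f n - (f (n + 1) + f (n - 1) + V n * f n)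
      = (Pi.single (0 : ℤ) (1 : ℝ) : ℤ → ℝ) n := by
    intro n
    have h1 : x • f - H f = lp.single 2 (0 : ℤ) (1 : ℝ) := by
      have := congrArg (fun A : lp (fun _ : ℤ => ℝ) 2 →L[ℝ] lp (fun _ : ℤ => ℝ) 2 =>
        A (lp.single 2 (0 : ℤ) (1 : ℝ))) hB
      exact this
    have h2 := congrArg (fun ψ : lp (fun _ : ℤ => ℝ) 2 => ψ n) h1
    simp only [lp.coeFn_sub, Pi.sub_apply, lp.coeFn_smul, Pi.smul_apply, smul_eq_mul, hH,
      lp.single_apply] at h2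
    exact h2
  have hrec0 : ∀ n, n ≠ 0 → f (n + 1) = (x - V n) * f n - f (n - 1) := by
    intro n hn
    have := hrec n
    rw [Pi.single_eq_of_ne hn] at this
    linarith
  have htwo : ∀ m m₁ m₂ : ℤ, (0 < m ∨ m + 2 * p ≤ 0) → m + p = m₁ → m + 2 * p = m₂ →
      f m₂ + f m = (discriminant V p).eval x * f m₁ := by
    rintro m _ _ hm rfl rfl
    have h := transfer_two_periods x hV (fun n => AddMonoidHom.mulLeft (f n)) m
      (fun j hj q => by
        simp only [AddMonoidHom.coe_mulLeft]
        rw [hrec0 _ (by omega)]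
        ring) 1
    simp only [AddMonoidHom.coe_mulLeft, mul_one] at h
    exact h.trans (by rw [eval_discriminant]; exact mul_comm _ _)
  have hinj : ∀ m c : ℤ, c ≠ 0 → Function.Injective fun k : ℕ => m + k * c := by
    intro m c hc j k h
    simpa [hc] using h
  have hright : ∀ m : ℤ, 0 < m → f m = 0 := by
    intro m hm
    have := eq_zero_of_recurrence_of_tendsto_zero hx (g := fun k : ℕ => f (m + k * p))
      (fun k => htwo (m + k * p) _ _ (Or.inl (by positivity)) (by push_cast; ring)
        (by push_cast; ring))
      ((lp_tendsto_cofinite f).comp ((hinj m p (by omega)).tendsto_cofinite.mono_left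
        Nat.cofinite_eq_atTop.ge))
    simpa using this
  have hleft : ∀ m : ℤ, m ≤ 0 → f m = 0 := by
    intro m hm
    have := eq_zero_of_recurrence_of_tendsto_zero hx (g := fun k : ℕ => f (m + k * (-p)))
      (fun k => by
        have hk : (0 : ℤ) ≤ k * p := by positivity
        exact (add_comm _ _).trans (htwo (m + (k + 2 : ℕ) * (-p)) _ _
          (Or.inr (by push_cast; linarith)) (by push_cast; ring) (by push_cast; ring)))
      ((lp_tendsto_cofinite f).comp ((hinj m (-p) (by omega)).tendsto_cofinite.mono_left
        Nat.cofinite_eq_atTop.ge))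
    simpa using this
  have h0 := hrec 0
  rw [hleft 0 le_rfl, hleft (0 - 1) (by norm_num), hright (0 + 1) (by norm_num)] at h0
  simp at h0

end Operator

/-- A quasi-periodic solution with unimodular multiplier forces the energy to be real. -/
theorem im_eq_zero_of_transfer_eigenvector (V : ℤ → ℝ) {p : ℕ} (hp : 1 ≤ p) {z μ : ℂ}
    (hμ : ‖μ‖ = 1) {v : Fin 2 → ℂ} (hv : v ≠ 0)
    (hvμ : (transfer z (fun n => (V n : ℂ)) 0 p).mulVec v = μ • v) : z.im = 0 := by
  set y : ℕ → Fin 2 → ℂ := fun k => (transfer z (fun n => (V n : ℂ)) 0 k).mulVec v with hy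
  have hstep : ∀ k : ℕ, y (k + 1) 0 = (z - V k) * y k 0 - y k 1 ∧ y (k + 1) 1 = y k 0 := by
    intro k
    simp only [hy, transfer_succ, ← Matrix.mulVec_mulVec]
    constructor <;> simp [transferStep, Matrix.mulVec, dotProduct, Fin.sum_univ_two,
      sub_eq_add_neg]
  have hy0 : y 0 = v := by simp only [hy, transfer_zero, Matrix.one_mulVec]
  have hyp : y p = μ • v := hvμ
  have hμ2 : μ.re * μ.re + μ.im * μ.im = 1 := by
    rw [← Complex.normSq_apply, Complex.normSq_eq_norm_sq, hμ, one_pow]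
  have hW : ∀ k : ℕ, (star (y (k + 1) 1) * y (k + 1) 0).im
      = (star (y k 1) * y k 0).im + z.im * Complex.normSq (y k 0) := by
    intro k
    rw [(hstep k).1, (hstep k).2]
    simp only [RCLike.star_def, Complex.mul_im, Complex.conj_re, Complex.conj_im, Complex.sub_re,
      Complex.sub_im, Complex.mul_re, Complex.ofReal_re, Complex.ofReal_im, Complex.normSq_apply]
    ring
  have hsum : ∀ k : ℕ, (star (y k 1) * y k 0).im
      = (star (y 0 1) * y 0 0).im + z.im * ∑ j ∈ Finset.range k, Complex.normSq (y j 0) := by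
    intro k
    induction k with
    | zero => simp
    | succ k ih => rw [hW, ih, Finset.sum_range_succ]; ring
  have hzero : z.im * ∑ j ∈ Finset.range p, Complex.normSq (y j 0) = 0 := by
    have h := hsum p
    rw [hyp, hy0] at h
    simp only [RCLike.star_def, Complex.mul_im, Complex.mul_re, Complex.conj_re, Complex.conj_im,
      Pi.smul_apply, smul_eq_mul] at h
    linear_combination -h + ((v 1).re * (v 0).im - (v 1).im * (v 0).re) * hμ2
  refine (mul_eq_zero.1 hzero).resolve_right fun h => hv ?_
  rw [Finset.sum_eq_zero_iff_of_nonneg fun j _ => Complex.normSq_nonneg _] at h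
  have hall : ∀ j < p, y j 0 = 0 := fun j hj =>
    Complex.normSq_eq_zero.1 (h j (Finset.mem_range.2 hj))
  have h0 : v 0 = 0 := by rw [← hy0]; exact hall 0 hp
  have h1 : v 1 = 0 := by
    have h2 := (hstep (p - 1)).2
    rw [Nat.sub_add_cancel hp, hall (p - 1) (by omega), hyp] at h2
    have hμ0 : μ ≠ 0 := by
      rintro rfl
      simp at hμ
    simpa [hμ0] using h2
  ext i
  fin_cases i <;> simp [h0, h1]

theorem exists_norm_eq_one_root {t : ℝ} (ht : |t| ≤ 2) :
    ∃ μ : ℂ, ‖μ‖ = 1 ∧ μ ^ 2 - t * μ + 1 = 0 := by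
  have hnn : 0 ≤ 1 - (t / 2) ^ 2 := by
    have := abs_le.1 ht
    nlinarith
  have hs := Real.sq_sqrt hnn
  generalize √(1 - (t / 2) ^ 2) = s at hs
  refine ⟨⟨t / 2, s⟩, ?_, ?_⟩
  · rw [← sq_eq_sq₀ (norm_nonneg _) zero_le_one, ← Complex.normSq_eq_norm_sq, Complex.normSq_mk]
    linarith
  · apply Complex.ext
    · simp [pow_two]
      nlinarith
    · simp [pow_two]
      ring

theorem im_eq_zero_of_aeval_discriminant_eq (V : ℤ → ℝ) {p : ℕ} (hp : 1 ≤ p) {t : ℝ}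
    (ht : |t| ≤ 2) {z : ℂ} (hz : aeval z (discriminant V p) = t) : z.im = 0 := by
  obtain ⟨μ, hμ, hroot⟩ := exists_norm_eq_one_root ht
  rw [aeval_discriminant] at hz
  set M := transfer z (fun n => (V n : ℂ)) 0 p with hM
  have htr : M 0 0 + M 1 1 = t := by rw [← Matrix.trace_fin_two]; exact hz
  have hdet := det_transfer z (fun n => (V n : ℂ)) 0 p
  rw [← hM, Matrix.det_fin_two] at hdet
  have hsing : (M - μ • (1 : Matrix (Fin 2) (Fin 2) ℂ)).det = 0 := by
    rw [Matrix.det_fin_two]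
    simp
    linear_combination hdet + hroot - μ * htr
  obtain ⟨v, hv, hMv⟩ := Matrix.exists_mulVec_eq_zero_iff.2 hsing
  refine im_eq_zero_of_transfer_eigenvector V hp hμ hv ?_
  rw [Matrix.sub_mulVec, Matrix.smul_mulVec, Matrix.one_mulVec, sub_eq_zero] at hMv
  exact hMv

/-- The solutions of `discriminant = t` approach `x` when `t` approaches the discriminant at `x`. -/
theorem exists_eval_discriminant_eq_near (V : ℤ → ℝ) {p : ℕ} (hp : 1 ≤ p) {t : ℝ} (ht : |t| ≤ 2)
    {x ε : ℝ} (hε : 0 < ε) (hx : |(discriminant V p).eval x - t| < ε ^ p) :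
    ∃ y : ℝ, (discriminant V p).eval y = t ∧ |x - y| < ε := by
  by_contra! hcon
  obtain ⟨hmonic, hdeg⟩ := discriminant_monic V hp
  set Q : ℂ[X] := (discriminant V p - C t).map (algebraMap ℝ ℂ) with hQ
  have hlt : (C t).degree < (discriminant V p).degree := by
    rw [degree_eq_natDegree hmonic.ne_zero, hdeg]
    exact degree_C_le.trans_lt (by exact_mod_cast hp)
  have hQm : Q.Monic := (hmonic.sub_of_left hlt).map _
  have hQd : Q.natDegree = p := by
    rw [hQ, natDegree_map, natDegree_sub_C, hdeg]
  have hsplit : Q.Splits := IsAlgClosed.splits Q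
  have heval := hsplit.eval_eq_prod_roots_of_monic hQm (x : ℂ)
  have hQx : Q.eval (x : ℂ) = (((discriminant V p).eval x - t : ℝ) : ℂ) := by
    have := eval_map_algebraMap (discriminant V p - C t) (x : ℂ)
    rw [hQ, this]
    have h2 := aeval_algebraMap_apply ℂ x (discriminant V p - C t)
    rw [coe_aeval_eq_eval, eval_sub, eval_C] at h2
    exact h2
  have hbound : ∀ w ∈ Q.roots, ε ≤ ‖(x : ℂ) - w‖ := by
    intro w hw
    have hw' : Q.eval w = 0 := (mem_roots'.1 hw).2
    rw [hQ, eval_map_algebraMap, map_sub, aeval_C, sub_eq_zero] at hw'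
    have him := im_eq_zero_of_aeval_discriminant_eq V hp ht hw'
    have hwre : w = ((w.re : ℝ) : ℂ) := Complex.ext rfl (by simp [him])
    rw [hwre] at hw' ⊢
    have h2 := aeval_algebraMap_apply ℂ w.re (discriminant V p)
    rw [coe_aeval_eq_eval] at h2
    have h3 := hcon w.re (Complex.ofReal_injective (h2.symm.trans hw'))
    rwa [← Complex.ofReal_sub, Complex.norm_real, Real.norm_eq_abs]
  have hprod : ∀ s : Multiset ℂ, (∀ w ∈ s, ε ≤ ‖(x : ℂ) - w‖) →
      ε ^ Multiset.card s ≤ ‖(s.map ((x : ℂ) - ·)).prod‖ := by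
    intro s
    induction s using Multiset.induction_on with
    | empty => simp
    | cons w s ih =>
      intro h
      rw [Multiset.card_cons, pow_succ', Multiset.map_cons, Multiset.prod_cons, norm_mul]
      exact mul_le_mul (h w (Multiset.mem_cons_self _ _))
        (ih fun u hu => h u (Multiset.mem_cons_of_mem hu)) (by positivity) (norm_nonneg _)
  have := hprod Q.roots hbound
  rw [← hsplit.natDegree_eq_card_roots, hQd, ← heval, hQx, Complex.norm_real,
    Real.norm_eq_abs] at this
  linarith

theorem exists_Ioo_abs_lt {f : ℝ → ℝ} (hf : Continuous f) {c x u v : ℝ} (hx : |f x| < c)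
    (hux : u ≤ x) (hxv : x ≤ v) (hu : c ≤ |f u|) (hv : c ≤ |f v|) :
    ∃ a b, x ∈ Set.Ioo a b ∧ |f a| = c ∧ |f b| = c ∧ ∀ y ∈ Set.Ioo a b, |f y| < c := by
  set S := {y | y ≤ x ∧ c ≤ |f y|} with hS
  set T := {y | x ≤ y ∧ c ≤ |f y|} with hT
  have hSc : IsClosed S := isClosed_Iic.inter (isClosed_le continuous_const hf.abs)
  have hTc : IsClosed T := isClosed_Ici.inter (isClosed_le continuous_const hf.abs)
  have hSb : BddAbove S := ⟨x, fun y hy => hy.1⟩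
  have hTb : BddBelow T := ⟨x, fun y hy => hy.1⟩
  have ha := hSc.csSup_mem ⟨u, hux, hu⟩ hSb
  have hb := hTc.csInf_mem ⟨v, hxv, hv⟩ hTb
  set a := sSup S
  set b := sInf T
  have hax : a < x := lt_of_le_of_ne ha.1 fun h => by
    rw [← h] at hx
    exact absurd ha.2 (not_le.2 hx)
  have hxb : x < b := lt_of_le_of_ne hb.1 fun h => by
    rw [h] at hx
    exact absurd hb.2 (not_le.2 hx)
  have hin : ∀ y ∈ Set.Ioo a b, |f y| < c := by
    intro y hy
    by_contra! hcy
    rcases le_total y x with h | h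
    · exact absurd (le_csSup hSb ⟨h, hcy⟩) (not_le.2 hy.1)
    · exact absurd (csInf_le hTb ⟨h, hcy⟩) (not_le.2 hy.2)
  have hcl : Set.Icc a b ⊆ {y | |f y| ≤ c} := by
    rw [← closure_Ioo (hax.trans hxb).ne]
    exact closure_minimal (fun y hy => (hin y hy).le) (isClosed_le hf.abs continuous_const)
  have hab := (hax.trans hxb).le
  exact ⟨a, b, ⟨hax, hxb⟩, le_antisymm (hcl ⟨le_rfl, hab⟩) ha.2,
    le_antisymm (hcl ⟨hab, le_rfl⟩) hb.2, hin⟩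

theorem Ioo_subset_Ioo_of_abs_lt {f : ℝ → ℝ} {c a b a' b' r : ℝ} (hr : r ∈ Set.Ioo a b)
    (hr' : r ∈ Set.Ioo a' b') (ha' : |f a'| = c) (hb' : |f b'| = c)
    (hin : ∀ y ∈ Set.Ioo a b, |f y| < c) : Set.Ioo a b ⊆ Set.Ioo a' b' := by
  refine Set.Ioo_subset_Ioo ?_ ?_
  · by_contra! h
    exact (hin a' ⟨h, hr'.1.trans hr.2⟩).ne ha'
  · by_contra! h
    exact (hin b' ⟨hr.1.trans hr'.2, h⟩).ne hb'

section Bands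

variable {V : ℤ → ℝ} {p : ℕ} {a b : ℝ}

theorem band_length_le (hp : 1 ≤ p) (hV : ∀ n : ℤ, V (n + p) = V n) (hab : a < b)
    (hin : ∀ y ∈ Set.Ioo a b, |(discriminant V p).eval y| < 2) : b - a ≤ 2 * Real.pi / p := by
  set D := discriminant V p with hD
  have hcont : Continuous fun y => Real.arcsin (D.eval y / 2) :=
    Real.continuous_arcsin.comp (D.continuous.div_const 2)
  have hpos : ∀ y ∈ Set.Ioo a b, 0 < 1 - (D.eval y / 2) ^ 2 := by
    intro y hy
    have := abs_lt.1 (hin y hy)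
    nlinarith
  have hderiv : ∀ y ∈ Set.Ioo a b, HasDerivAt (fun y => Real.arcsin (D.eval y / 2))
      (1 / √(1 - (D.eval y / 2) ^ 2) * ((derivative D).eval y / 2)) y := by
    intro y hy
    have := abs_lt.1 (hin y hy)
    exact (Real.hasDerivAt_arcsin (by linarith) (by linarith)).comp y
      ((D.hasDerivAt y).div_const 2)
  obtain ⟨c, hc, hslope⟩ := exists_hasDerivAt_eq_slope _ _ hab hcont.continuousOn hderiv
  have hs := Real.sqrt_pos.2 (hpos c hc)
  have hlow : (p : ℝ) / 2 ≤ |1 / √(1 - (D.eval c / 2) ^ 2) * ((derivative D).eval c / 2)| := by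
    have := abs_derivative_discriminant hV (hin c hc)
    rw [abs_mul, abs_of_pos (one_div_pos.2 hs), abs_div, abs_two, div_mul_eq_mul_div, one_mul,
      le_div_iff₀ hs]
    linarith
  have hpi : |Real.arcsin (D.eval b / 2) - Real.arcsin (D.eval a / 2)| ≤ Real.pi := by
    rw [abs_le]
    constructor <;>
    linarith [Real.arcsin_le_pi_div_two (D.eval b / 2), Real.neg_pi_div_two_le_arcsin (D.eval b / 2),
      Real.arcsin_le_pi_div_two (D.eval a / 2), Real.neg_pi_div_two_le_arcsin (D.eval a / 2)]
  have hba : 0 < b - a := sub_pos.2 hab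
  rw [hslope, abs_div, abs_of_pos hba, le_div_iff₀ hba] at hlow
  rw [le_div_iff₀ (by exact_mod_cast hp)]
  linarith

theorem exists_root_in_band (hp : 1 ≤ p) (hV : ∀ n : ℤ, V (n + p) = V n) (hab : a < b)
    (ha : |(discriminant V p).eval a| = 2) (hb : |(discriminant V p).eval b| = 2)
    (hin : ∀ y ∈ Set.Ioo a b, |(discriminant V p).eval y| < 2) :
    ∃ r ∈ Set.Ioo a b, (discriminant V p).eval r = 0 := by
  set D := discriminant V p with hD
  have hne : D.eval a ≠ D.eval b := by
    intro h
    obtain ⟨c, hc, h0⟩ := exists_hasDerivAt_eq_zero hab D.continuousOn h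
      (fun y _ => D.hasDerivAt y)
    have h1 := abs_derivative_discriminant hV (hin c hc)
    have h2 : 0 < 1 - (D.eval c / 2) ^ 2 := by
      have := abs_lt.1 (hin c hc)
      nlinarith
    have h3 : (0 : ℝ) < p := by exact_mod_cast hp
    rw [h0, abs_zero] at h1
    exact absurd h1 (not_le.2 (mul_pos h3 (Real.sqrt_pos.2 h2)))
  rcases eq_or_eq_neg_of_abs_eq ha with h1 | h1 <;> rcases eq_or_eq_neg_of_abs_eq hb with h2 | h2
  · exact absurd (h1.trans h2.symm) hne
  · obtain ⟨r, hr, h⟩ := intermediate_value_Ioo' hab.le D.continuousOn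
      (show (0 : ℝ) ∈ Set.Ioo (D.eval b) (D.eval a) by rw [h1, h2]; norm_num)
    exact ⟨r, hr, h⟩
  · obtain ⟨r, hr, h⟩ := intermediate_value_Ioo hab.le D.continuousOn
      (show (0 : ℝ) ∈ Set.Ioo (D.eval a) (D.eval b) by rw [h1, h2]; norm_num)
    exact ⟨r, hr, h⟩
  · exact absurd (h1.trans h2.symm) hne

theorem setOf_abs_discriminant_le_subset_closure (hp : 1 ≤ p) :
    {x | |(discriminant V p).eval x| ≤ 2} ⊆ closure {x | |(discriminant V p).eval x| < 2} := by
  intro x hx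
  set s := (discriminant V p).eval x with hs
  rw [Metric.mem_closure_iff]
  intro ε hε
  have hlim : Filter.Tendsto (fun δ : ℝ => |s - (1 - δ) * s|) (nhdsWithin 0 (Set.Ioi 0))
      (nhds 0) := by
    have : Continuous fun δ : ℝ => |s - (1 - δ) * s| := by fun_prop
    simpa using (this.tendsto 0).mono_left nhdsWithin_le_nhds
  have hev := hlim.eventually (gt_mem_nhds (pow_pos hε p))
  obtain ⟨δ, hδ, hδ1⟩ := (hev.and (Ioo_mem_nhdsGT (zero_lt_one))).exists
  have ht : |(1 - δ) * s| < 2 := by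
    rw [abs_mul, abs_of_pos (by linarith [hδ1.2])]
    have hx' : |s| ≤ 2 := hx
    nlinarith [abs_nonneg s, hδ1.1, hδ1.2]
  obtain ⟨y, hy, hxy⟩ := exists_eval_discriminant_eq_near V hp ht.le hε hδ
  exact ⟨y, show |(discriminant V p).eval y| < 2 by rwa [hy], by rwa [Real.dist_eq]⟩

end Bands

/-- For a `p`-periodic potential `V : ℤ → ℝ` (`p ≥ 1`), the
spectrum of the Schrödinger operator `H` on `ℓ²(ℤ)` with potential `V` is a
union of `p` closed intervals, each of Lebesgue measure (i.e. length) at most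
`2π/p`. -/
theorem statement7
    (p : ℕ) (hp : 1 ≤ p) (V : ℤ → ℝ) (hV : ∀ n : ℤ, V (n + p) = V n)
    (H : lp (fun _ : ℤ => ℝ) 2 →L[ℝ] lp (fun _ : ℤ => ℝ) 2)
    (hH : ∀ ψ : lp (fun _ : ℤ => ℝ) 2, ∀ n : ℤ,
        H ψ n = ψ (n + 1) + ψ (n - 1) + V n * ψ n) :
    ∃ a b : Fin p → ℝ, (∀ i, a i ≤ b i) ∧
      spectrum ℝ H = ⋃ i, Set.Icc (a i) (b i) ∧
      ∀ i, b i - a i ≤ 2 * Real.pi / p := by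
  set D := discriminant V p with hD
  have hspec : spectrum ℝ H = {x | |D.eval x| ≤ 2} := Set.ext fun x =>
    ⟨abs_discriminant_le_of_mem_spectrum hV hH, mem_spectrum_of_abs_discriminant_le hp hV hH⟩
  obtain ⟨hmonic, hdeg⟩ := discriminant_monic V hp
  obtain ⟨r, hr⟩ := (spectrum.isBounded (𝕜 := ℝ) H).subset_closedBall 0
  have houtside : ∀ y, r < |y| → 2 ≤ |D.eval y| := by
    intro y hy
    by_contra! h
    have := hr (hspec ▸ h.le : y ∈ spectrum ℝ H)
    rw [mem_closedBall_zero_iff, Real.norm_eq_abs] at this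
    linarith
  have hband : ∀ x, |D.eval x| < 2 → ∃ a b, x ∈ Set.Ioo a b ∧ |D.eval a| = 2 ∧
      |D.eval b| = 2 ∧ ∀ y ∈ Set.Ioo a b, |D.eval y| < 2 := fun x hx => by
    have h1 := abs_nonneg r
    have h2 := abs_nonneg x
    have h3 := le_abs_self r
    have h4 := le_abs_self x
    have h5 := neg_abs_le x
    refine exists_Ioo_abs_lt D.continuous hx (u := -(|r| + |x| + 1)) (v := |r| + |x| + 1)
      (by linarith) (by linarith) (houtside _ ?_) (houtside _ ?_)
    · rw [abs_neg, abs_of_nonneg (by linarith)]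
      linarith
    · rw [abs_of_nonneg (by linarith)]
      linarith
  choose A B hmem hA hB hin using hband
  have hroot : ∀ z : D.roots.toFinset, |D.eval z.1| < 2 := fun z => by
    have := (mem_roots'.1 (Multiset.mem_toFinset.1 z.2)).2
    rw [this.eq_zero, abs_zero]
    exact two_pos
  have hmem_roots : ∀ x, D.eval x = 0 → x ∈ D.roots.toFinset := fun x hx =>
    Multiset.mem_toFinset.2 ((mem_roots hmonic.ne_zero).2 hx)
  have hcard : Fintype.card D.roots.toFinset ≤ Fintype.card (Fin p) := by
    rw [Fintype.card_coe, Fintype.card_fin]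
    exact (Multiset.toFinset_card_le _).trans (hdeg ▸ card_roots' D)
  obtain ⟨y, hy, -⟩ := exists_eval_discriminant_eq_near V hp (t := 0) (by norm_num)
    (x := 0) (ε := |D.eval 0| + 1) (by positivity) (by
      rw [sub_zero]
      exact (lt_add_one _).trans_le
        (le_self_pow₀ (by linarith [abs_nonneg (D.eval 0)]) (by omega)))
  have : Nonempty D.roots.toFinset := ⟨⟨y, hmem_roots y hy⟩⟩
  obtain ⟨ι⟩ := Function.Embedding.nonempty_of_card_le hcard
  set e : Fin p → D.roots.toFinset := Function.invFun ι
  have he : Function.Surjective e := Function.invFun_surjective ι.injective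
  have hlt : ∀ i, A _ (hroot (e i)) < B _ (hroot (e i)) := fun i =>
    (hmem _ (hroot (e i))).1.trans (hmem _ (hroot (e i))).2
  refine ⟨fun i => A _ (hroot (e i)), fun i => B _ (hroot (e i)), fun i => (hlt i).le, ?_,
    fun i => band_length_le hp hV (hlt i) (hin _ (hroot (e i)))⟩
  rw [hspec]
  apply Set.Subset.antisymm
  · refine (setOf_abs_discriminant_le_subset_closure hp).trans
      (closure_minimal ?_ (isClosed_iUnion_of_finite fun i => isClosed_Icc))
    intro x hx
    obtain ⟨z, hz, hz0⟩ := exists_root_in_band hp hV ((hmem x hx).1.trans (hmem x hx).2)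
      (hA x hx) (hB x hx) (hin x hx)
    obtain ⟨i, hi⟩ := he ⟨z, hmem_roots z hz0⟩
    have hz' : ∀ w : D.roots.toFinset, w = ⟨z, hmem_roots z hz0⟩ →
        z ∈ Set.Ioo (A w (hroot w)) (B w (hroot w)) := by
      rintro _ rfl
      exact hmem _ _
    rw [Set.mem_iUnion]
    refine ⟨i, Set.Ioo_subset_Icc_self (Ioo_subset_Ioo_of_abs_lt (f := fun y => D.eval y) hz
      (hz' _ hi) (hA _ (hroot (e i))) (hB _ (hroot (e i))) (hin x hx) (hmem x hx))⟩
  · refine Set.iUnion_subset fun i => ?_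
    rw [← closure_Ioo (hlt i).ne]
    exact closure_minimal (fun y hy => (hin _ (hroot (e i)) y hy).le)
      (isClosed_le D.continuous.abs continuous_const)
end

section
/- Let p ≥ 2, let V : ℤ → ℝ be periodic with period p, and let H be the Schrödinger operator on ℓ²(ℤ) with potential V. For k ∈ ℝ and l ∈ ℤ, let A_l^k be the p×p Hermitian matrix with diagonal entries V(l), …, V(l+p−1), entries 1 on the first sub- and superdiagonal, entry e^{−ikp} in the upper-right corner, entry e^{ikp} in the lower-left corner, and all other entries 0. Then the p eigenvalues of A_l^k do not depend on l, and σ(H) = ⋃_{k ∈ ℝ} {eigenvalues of A_0^k}. -/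
namespace PeriodicSchrodinger

open Polynomial

section Sequences

lemma hasSum_sq_norm (g : lp (fun _ : ℤ => ℝ) 2) : HasSum (fun n => g n ^ 2) (‖g‖ ^ 2) := by
  have := lp.hasSum_norm (p := 2) (by norm_num) g
  simpa using this

lemma hasSum_sq_le_of_abs_le_translates {f g : ℤ → ℝ} {F G c : ℝ}
    (hf : HasSum (fun n => f n ^ 2) F) (hg : HasSum (fun n => g n ^ 2) G) (a b : ℤ)
    (h : ∀ n, |f n| ≤ c * (|g (n + a)| + |g (n + b)|)) : F ≤ 4 * c ^ 2 * G := by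
  have ha : HasSum (fun n => g (n + a) ^ 2) G :=
    (Equiv.addRight a).hasSum_iff (f := fun n => g n ^ 2) |>.mpr hg
  have hb : HasSum (fun n => g (n + b) ^ 2) G :=
    (Equiv.addRight b).hasSum_iff (f := fun n => g n ^ 2) |>.mpr hg
  have hle : F ≤ 2 * c ^ 2 * (G + G) := by
    refine hasSum_le (fun n => ?_) hf ((ha.add hb).mul_left (2 * c ^ 2))
    have h1 : f n ^ 2 ≤ (c * (|g (n + a)| + |g (n + b)|)) ^ 2 :=
      sq_le_sq' (by linarith [neg_abs_le (f n), h n]) ((le_abs_self _).trans (h n))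
    rw [← sq_abs (g (n + a)), ← sq_abs (g (n + b))]
    nlinarith [mul_nonneg (sq_nonneg c) (sq_nonneg (|g (n + a)| - |g (n + b)|))]
  linarith

/-- A sequence dominated by the sum of two translates of `g ∈ ℓ²(ℤ)` has norm at most twice that
of `g`. -/
lemma norm_le_of_abs_le_translates (f g : lp (fun _ : ℤ => ℝ) 2) {c : ℝ} (hc : 0 ≤ c) (a b : ℤ)
    (h : ∀ n, |f n| ≤ c * (|g (n + a)| + |g (n + b)|)) : ‖f‖ ≤ 2 * c * ‖g‖ := by
  have hle := hasSum_sq_le_of_abs_le_translates (hasSum_sq_norm f) (hasSum_sq_norm g) a b h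
  refine le_of_sq_le_sq ?_ (by positivity)
  linarith

lemma memℓp_two_geometric_mul {ψ : ℤ → ℝ} {C r : ℝ} (hψ : ∀ n, |ψ n| ≤ C) (hr0 : 0 ≤ r)
    (hr1 : r < 1) : Memℓp (fun n : ℤ => r ^ n.natAbs * ψ n) 2 := by
  have hC : 0 ≤ C := (abs_nonneg _).trans (hψ 0)
  have hgeom : Summable fun n : ℕ => (r ^ 2) ^ n * C ^ 2 :=
    (summable_geometric_of_lt_one (by positivity) (by nlinarith)).mul_right _
  have hsum : Summable fun n : ℤ => (r ^ 2) ^ n.natAbs * C ^ 2 :=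
    Summable.of_nat_of_neg (by simpa using hgeom) (by simpa using hgeom)
  refine memℓp_gen (hsum.of_nonneg_of_le (fun n => by positivity) fun n => ?_)
  have : ‖r ^ n.natAbs * ψ n‖ ^ 2 ≤ (r ^ 2) ^ n.natAbs * C ^ 2 := by
    rw [Real.norm_eq_abs, abs_mul, mul_pow, sq_abs, ← pow_mul, ← pow_mul, mul_comm 2]
    gcongr
    exact hψ n
  simpa using this

lemma abs_geometric_sub_le {r : ℝ} (hr0 : 0 < r) (hr1 : r < 1) {m n : ℤ}
    (h : m = n + 1 ∨ n = m + 1) :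
    |r ^ m.natAbs - r ^ n.natAbs| ≤ (r⁻¹ - 1) * r ^ m.natAbs := by
  have hr : 0 ≤ r⁻¹ - 1 := by
    have := (one_lt_inv₀ hr0).mpr hr1
    linarith
  have : n.natAbs = m.natAbs + 1 ∨ m.natAbs = n.natAbs + 1 := by omega
  rcases this with h | h
  · have hp : 0 < r ^ m.natAbs := by positivity
    rw [h, pow_succ, abs_of_nonneg (by nlinarith)]
    have : (1 - r) ≤ r⁻¹ - 1 := by
      have h2 : r * r⁻¹ = 1 := mul_inv_cancel₀ hr0.ne'
      nlinarith
    nlinarith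
  · have hp : 0 < r ^ n.natAbs := by positivity
    rw [h, pow_succ, abs_of_nonpos (by nlinarith)]
    have : (r⁻¹ - 1) * (r ^ n.natAbs * r) = r ^ n.natAbs * (1 - r) := by
      field_simp
    linarith

end Sequences

section Operator

variable {V : ℤ → ℝ} {H : lp (fun _ : ℤ => ℝ) 2 →L[ℝ] lp (fun _ : ℤ => ℝ) 2}

/-- An energy with a nonzero bounded generalized eigenfunction lies in the spectrum. -/
lemma mem_spectrum_of_bounded_solution
    (hH : ∀ ψ : lp (fun _ : ℤ => ℝ) 2, ∀ n : ℤ,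
      H ψ n = ψ (n + 1) + ψ (n - 1) + V n * ψ n)
    {E C : ℝ} {ψ : ℤ → ℝ} (hC : ∀ n, |ψ n| ≤ C) (hne : ∃ n, ψ n ≠ 0)
    (hsol : ∀ n, ψ (n + 1) + ψ (n - 1) + V n * ψ n = E * ψ n) :
    E ∈ spectrum ℝ H := by
  rw [spectrum.mem_iff]
  rintro ⟨u, hu⟩
  set B : ℝ := ‖(↑u⁻¹ : lp (fun _ : ℤ => ℝ) 2 →L[ℝ] lp (fun _ : ℤ => ℝ) 2)‖ with hB
  have hB0 : 0 ≤ B := norm_nonneg _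
  set c : ℝ := 1 / (2 * (B + 1)) with hcdef
  have hc : 0 < c := by positivity
  set r : ℝ := (1 + c)⁻¹ with hr
  have hr0 : 0 < r := by positivity
  have hr1 : r < 1 := inv_lt_one_of_one_lt₀ (by linarith)
  have hrc : r⁻¹ - 1 = c := by rw [hr, inv_inv]; ring
  let φ : lp (fun _ : ℤ => ℝ) 2 := ⟨_, memℓp_two_geometric_mul hC hr0.le hr1⟩
  have hφ : ∀ n, φ n = r ^ n.natAbs * ψ n := fun n => rfl
  have hφ0 : 0 < ‖φ‖ := by
    rw [norm_pos_iff]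
    intro h0
    obtain ⟨n, hn⟩ := hne
    have : φ n = 0 := by rw [h0]; rfl
    rw [hφ] at this
    exact (mul_ne_zero (by positivity) hn) this
  have huφ : ∀ n, (u.val φ) n = E * φ n - H φ n := fun n => by
    rw [hu]; rfl
  have hle : ‖u.val φ‖ ≤ 2 * c * ‖φ‖ := by
    refine norm_le_of_abs_le_translates _ _ hc.le 1 (-1) fun n => ?_
    have h1 := abs_geometric_sub_le hr0 hr1 (m := n + 1) (n := n) (Or.inl rfl)
    have h2 := abs_geometric_sub_le hr0 hr1 (m := n - 1) (n := n) (Or.inr (by ring))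
    rw [hrc] at h1 h2
    have e : (u.val φ) n = -((r ^ (n + 1).natAbs - r ^ n.natAbs) * ψ (n + 1)
        + (r ^ (n - 1).natAbs - r ^ n.natAbs) * ψ (n - 1)) := by
      rw [huφ, hH, hφ, hφ, hφ]
      linear_combination -(r ^ n.natAbs) * hsol n
    rw [e, abs_neg, ← sub_eq_add_neg, hφ, hφ, abs_mul, abs_mul,
      abs_of_pos (a := r ^ (n + 1).natAbs) (by positivity),
      abs_of_pos (a := r ^ (n - 1).natAbs) (by positivity)]
    refine (abs_add_le _ _).trans ?_
    rw [abs_mul, abs_mul, mul_add, ← mul_assoc, ← mul_assoc]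
    gcongr
  have hinv : φ = (↑u⁻¹ : lp (fun _ : ℤ => ℝ) 2 →L[ℝ] lp (fun _ : ℤ => ℝ) 2) (u.val φ) := by
    rw [← mul_apply_eq_comp, Units.inv_mul]; rfl
  have h3 : ‖φ‖ ≤ B * ‖u.val φ‖ := by
    conv_lhs => rw [hinv]
    exact ContinuousLinearMap.le_opNorm _ _
  have h4 : ‖φ‖ ≤ B * (2 * c * ‖φ‖) := h3.trans (by gcongr)
  have h5 : 2 * c * (B + 1) = 1 := by rw [hcdef]; field_simp
  nlinarith

/-- One step of the transfer matrix recursion, with the energy as indeterminate. -/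
noncomputable def transferStep (V : ℤ → ℝ) (n : ℤ) : Matrix (Fin 2) (Fin 2) ℝ[X] :=
  !![X - C (V n), -1; 1, 0]

/-- The transfer matrix from the site `l` over `j` steps. -/
noncomputable def transfer (V : ℤ → ℝ) (l : ℤ) : ℕ → Matrix (Fin 2) (Fin 2) ℝ[X]
  | 0 => 1
  | j + 1 => transferStep V (l + j) * transfer V l j

lemma det_transferStep (V : ℤ → ℝ) (n : ℤ) : (transferStep V n).det = 1 := by
  simp [transferStep]

lemma det_transfer (V : ℤ → ℝ) (l : ℤ) (j : ℕ) : (transfer V l j).det = 1 := by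
  induction j with
  | zero => simp [transfer]
  | succ j ih => rw [transfer, Matrix.det_mul, ih, det_transferStep, one_mul]

lemma transfer_succ_left (V : ℤ → ℝ) (l : ℤ) (j : ℕ) :
    transfer V (l + 1) j * transferStep V l = transferStep V (l + j) * transfer V l j := by
  induction j with
  | zero => simp [transfer]
  | succ j ih =>
    rw [transfer, mul_assoc, ih, transfer]
    push_cast
    rw [add_assoc l, add_comm (1 : ℤ)]

lemma transfer_zero_row (V : ℤ → ℝ) (l : ℤ) (j : ℕ) (i : Fin 2) :
    transfer V l (j + 1) 0 i = (X - C (V (l + j))) * transfer V l j 0 i - transfer V l j 1 i := by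
  simp [transfer, transferStep, Matrix.mul_apply, Fin.sum_univ_two]
  ring

lemma transfer_one_row (V : ℤ → ℝ) (l : ℤ) (j : ℕ) (i : Fin 2) :
    transfer V l (j + 1) 1 i = transfer V l j 0 i := by
  simp [transfer, transferStep, Matrix.mul_apply, Fin.sum_univ_two]

/-- The discriminant of a potential of period `p`. -/
noncomputable def discriminant (V : ℤ → ℝ) (p : ℕ) : ℝ[X] := (transfer V 0 p).trace

lemma transfer_add_period {p : ℕ} (hV : ∀ n : ℤ, V (n + p) = V n) (l : ℤ) (j : ℕ) :
    transfer V (l + p) j = transfer V l j := by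
  induction j with
  | zero => rfl
  | succ j ih =>
    rw [transfer, transfer, ih, add_right_comm]
    simp only [transferStep, hV]

lemma trace_transfer_succ {p : ℕ} (hV : ∀ n : ℤ, V (n + p) = V n) (l : ℤ) :
    (transfer V (l + 1) p).trace = (transfer V l p).trace := by
  have h := transfer_succ_left V l p
  have hstep : transferStep V (l + p) = transferStep V l := by simp only [transferStep, hV]
  have hinv : transferStep V l * (transferStep V l).adjugate = 1 := by
    rw [Matrix.mul_adjugate, det_transferStep, one_smul]
  have hinv' : (transferStep V l).adjugate * transferStep V l = 1 := by
    rw [Matrix.adjugate_mul, det_transferStep, one_smul]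
  rw [← mul_one (transfer V (l + 1) p), ← hinv, ← mul_assoc, h, hstep, Matrix.trace_mul_comm,
    ← mul_assoc, hinv', one_mul]

lemma trace_transfer {p : ℕ} (hV : ∀ n : ℤ, V (n + p) = V n) (l : ℤ) :
    (transfer V l p).trace = discriminant V p := by
  induction l using Int.induction_on with
  | zero => rfl
  | succ l ih => rw [trace_transfer_succ hV, ih]
  | pred l ih => rw [← trace_transfer_succ hV, sub_add_cancel, ih]

lemma eval_eq_aeval_transfer
    (hH : ∀ ψ : lp (fun _ : ℤ => ℝ) 2, ∀ n : ℤ,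
      H ψ n = ψ (n + 1) + ψ (n - 1) + V n * ψ n) (l : ℤ) (j : ℕ) :
    ∀ ψ : lp (fun _ : ℤ => ℝ) 2,
    ψ (l + j) = aeval H (transfer V l j 0 0) ψ l + aeval H (transfer V l j 0 1) ψ (l - 1) ∧
    ψ (l + j - 1) =
      aeval H (transfer V l j 1 0) ψ l + aeval H (transfer V l j 1 1) ψ (l - 1) := by
  induction j with
  | zero => intro ψ; simp [transfer]
  | succ j ih =>
    intro ψ
    obtain ⟨h0, h1⟩ := ih ψ
    obtain ⟨hX, -⟩ := ih (H ψ)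
    constructor
    · have e := hH ψ (l + j)
      have comm : ∀ q : ℝ[X], ∀ n, (aeval H q) (H ψ) n = (aeval H (X * q)) ψ n := fun q n => by
        rw [mul_comm, map_mul, aeval_X]; rfl
      rw [comm, comm] at hX
      rw [transfer_zero_row, transfer_zero_row]
      have key : ∀ (q s : ℝ[X]) (n : ℤ), (aeval H ((X - C (V (l + j))) * q - s)) ψ n =
          aeval H (X * q) ψ n - V (l + j) * aeval H q ψ n - aeval H s ψ n := fun q s n => by
        rw [sub_mul, map_sub, map_sub, C_mul']
        simp
        rfl
      rw [key, key]
      push_cast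
      rw [← add_assoc]
      linear_combination -e + hX - V (l + j) * h0 - h1
    · rw [transfer_one_row, transfer_one_row]
      push_cast
      rw [← add_assoc, add_sub_cancel_right]
      exact h0

/-- The discriminant evaluated at `H` is the sum of the two translations by one period. -/
lemma aeval_discriminant {p : ℕ} (hV : ∀ n : ℤ, V (n + p) = V n)
    (hH : ∀ ψ : lp (fun _ : ℤ => ℝ) 2, ∀ n : ℤ,
      H ψ n = ψ (n + 1) + ψ (n - 1) + V n * ψ n)
    (ψ : lp (fun _ : ℤ => ℝ) 2) (l : ℤ) :
    aeval H (discriminant V p) ψ l = ψ (l + p) + ψ (l - p) := by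
  have hP : transfer V (l - p) p = transfer V l p := by
    rw [← transfer_add_period hV (l - p), sub_add_cancel]
  have hdet := det_transfer V l p
  rw [Matrix.det_fin_two] at hdet
  rw [← trace_transfer hV l, Matrix.trace_fin_two]
  set P := transfer V l p
  have h := (eval_eq_aeval_transfer hH l p ψ).1
  have h0 := (eval_eq_aeval_transfer hH (l - p) p (aeval H (P 1 1) ψ)).1
  have h1 := (eval_eq_aeval_transfer hH (l - p) p (aeval H (P 0 1) ψ)).2
  rw [hP, sub_add_cancel] at h0 h1
  change _ = aeval H (P 0 0) ψ l + aeval H (P 0 1) ψ (l - 1) at h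
  have mulr : ∀ (q s : ℝ[X]) (n : ℤ), aeval H q (aeval H s ψ) n = aeval H (q * s) ψ n :=
    fun q s n => by rw [map_mul]; rfl
  rw [mulr, mulr] at h0 h1
  have hd : aeval H (P 0 0 * P 1 1) ψ (l - p) - aeval H (P 1 0 * P 0 1) ψ (l - p)
      = ψ (l - p) := by
    rw [mul_comm (P 1 0)]
    have : aeval H (P 0 0 * P 1 1 - P 0 1 * P 1 0) ψ (l - p) = ψ (l - p) := by
      rw [hdet]; simp
    rw [map_sub] at this
    simpa using this
  have hs : aeval H (P 0 0 + P 1 1) ψ l = aeval H (P 0 0) ψ l + aeval H (P 1 1) ψ l := by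
    rw [map_add]; rfl
  rw [hs, h, h0, h1, mul_comm (P 1 1) (P 0 1), ← hd]
  ring

lemma abs_eval_discriminant_le_two {p : ℕ} (hV : ∀ n : ℤ, V (n + p) = V n)
    (hH : ∀ ψ : lp (fun _ : ℤ => ℝ) 2, ∀ n : ℤ,
      H ψ n = ψ (n + 1) + ψ (n - 1) + V n * ψ n)
    {E : ℝ} (hE : E ∈ spectrum ℝ H) : |(discriminant V p).eval E| ≤ 2 := by
  have hmem : (discriminant V p).eval E ∈ spectrum ℝ (aeval H (discriminant V p)) :=
    spectrum.subset_polynomial_aeval H _ ⟨E, hE, rfl⟩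
  have hnorm : ‖aeval H (discriminant V p)‖ ≤ 2 := by
    refine ContinuousLinearMap.opNorm_le_bound _ (by norm_num) fun ψ => ?_
    have := norm_le_of_abs_le_translates (aeval H (discriminant V p) ψ) ψ zero_le_one p (-p)
      fun n => by
        rw [aeval_discriminant hV hH, one_mul, ← sub_eq_add_neg]
        exact abs_add_le _ _
    simpa using this
  calc |(discriminant V p).eval E|
      ≤ ‖aeval H (discriminant V p)‖ * ‖(1 : lp (fun _ : ℤ => ℝ) 2 →L[ℝ] _)‖ :=
        spectrum.norm_le_norm_mul_of_mem hmem
    _ ≤ 2 * 1 := mul_le_mul hnorm ContinuousLinearMap.norm_id_le (norm_nonneg _) (by norm_num)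
    _ = 2 := mul_one 2

end Operator

section Bloch

variable {p : ℕ}

/-- The extension of `u : Fin p → ℂ` to the sequence on `ℤ` picking up a factor `z` over each
period. -/
noncomputable def blochExtend (hp : 0 < p) (z : ℂ) (u : Fin p → ℂ) (n : ℤ) : ℂ :=
  z ^ (n / (p : ℤ)) * u ⟨(n % p).toNat, by
    have := Int.emod_nonneg n (b := p) (by omega)
    have := Int.emod_lt_of_pos n (b := p) (by omega)
    omega⟩

lemma blochExtend_coe (hp : 0 < p) (z : ℂ) (u : Fin p → ℂ) (i : Fin p) :
    blochExtend hp z u (i : ℕ) = u i := by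
  have h1 : ((i : ℕ) : ℤ) / (p : ℤ) = 0 := Int.ediv_eq_zero_of_lt (by omega) (by omega)
  have h2 : ((i : ℕ) : ℤ) % (p : ℤ) = (i : ℕ) := Int.emod_eq_of_lt (by omega) (by omega)
  simp [blochExtend, h1, h2]

lemma blochExtend_add_period (hp : 0 < p) {z : ℂ} (hz : z ≠ 0) (u : Fin p → ℂ) (n : ℤ) :
    blochExtend hp z u (n + p) = z * blochExtend hp z u n := by
  have h1 : (n + p) / (p : ℤ) = n / p + 1 := by
    simpa using Int.add_mul_ediv_right n 1 (c := (p : ℤ)) (by omega)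
  simp only [blochExtend, h1, Int.add_emod_right]
  rw [zpow_add_one₀ hz]
  ring

lemma eq_zpow_mul_of_add_period {z : ℂ} (hz : z ≠ 0) {x : ℤ → ℂ}
    (hx : ∀ n, x (n + p) = z * x n) (n q : ℤ) : x (n + p * q) = z ^ q * x n := by
  induction q using Int.induction_on with
  | zero => simp
  | succ q ih =>
    rw [mul_add, mul_one, ← add_assoc, hx, ih, zpow_add_one₀ hz]
    ring
  | pred q ih =>
    have h := hx (n + p * (-q - 1))
    rw [show n + p * (-(q : ℤ) - 1) + p = n + p * (-q) by ring, ih] at h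
    rw [zpow_sub_one₀ hz, mul_right_comm, h]
    field_simp

lemma eq_blochExtend (hp : 0 < p) {z : ℂ} (hz : z ≠ 0) {x : ℤ → ℂ}
    (hx : ∀ n, x (n + p) = z * x n) (n : ℤ) :
    x n = blochExtend hp z (fun i => x (i : ℕ)) n := by
  have h := eq_zpow_mul_of_add_period hz hx (n % p) (n / p)
  rw [Int.emod_add_mul_ediv] at h
  rw [h, blochExtend, Int.toNat_of_nonneg (Int.emod_nonneg n (by omega))]

lemma norm_blochExtend_le (hp : 0 < p) {z : ℂ} (hz : ‖z‖ = 1) (u : Fin p → ℂ) (n : ℤ) :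
    ‖blochExtend hp z u n‖ ≤ ‖u‖ := by
  rw [blochExtend, norm_mul, norm_zpow, hz, one_zpow, one_mul]
  exact norm_le_pi_norm u _

/-- Translation by `m` sites, transported to vectors over one period. -/
noncomputable def blochShift (hp : 0 < p) (z : ℂ) (m : ℤ) : (Fin p → ℂ) →ₗ[ℂ] (Fin p → ℂ) where
  toFun u i := blochExtend hp z u ((i : ℕ) + m)
  map_add' u w := by ext i; simp [blochExtend, mul_add]
  map_smul' c u := by ext i; simp [blochExtend, mul_left_comm]

lemma blochExtend_blochShift (hp : 0 < p) {z : ℂ} (hz : z ≠ 0) (m : ℤ) (u : Fin p → ℂ) (n : ℤ) :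
    blochExtend hp z (blochShift hp z m u) n = blochExtend hp z u (n + m) :=
  (eq_blochExtend hp hz (x := fun n => blochExtend hp z u (n + m))
    (fun n => by rw [add_right_comm, blochExtend_add_period hp hz]) n).symm

lemma blochShift_blochShift (hp : 0 < p) {z : ℂ} (hz : z ≠ 0) {m m' : ℤ} (hm : m' + m = 0)
    (u : Fin p → ℂ) : blochShift hp z m' (blochShift hp z m u) = u := by
  ext i
  change blochExtend hp z (blochShift hp z m u) _ = _
  rw [blochExtend_blochShift hp hz, add_assoc, hm, add_zero, blochExtend_coe]

/-- Translation by one site as a linear automorphism. -/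
noncomputable def blochShiftEquiv (hp : 0 < p) {z : ℂ} (hz : z ≠ 0) :
    (Fin p → ℂ) ≃ₗ[ℂ] (Fin p → ℂ) :=
  LinearEquiv.ofLinearMap (blochShift hp z 1) (blochShift hp z (-1))
    (LinearMap.ext fun u => blochShift_blochShift hp hz (by norm_num) u)
    (LinearMap.ext fun u => blochShift_blochShift hp hz (by norm_num) u)

/-- The Bloch matrix acts on one period of a twisted sequence as the Schrödinger operator. -/
lemma mulVec_apply_eq {z w : ℂ} {v : Fin p → ℂ} {A : Matrix (Fin p) (Fin p) ℂ}
    (hA : ∀ i j : Fin p, A i j = (if i = j then v i else 0)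
      + (if (i : ℕ) + 1 = (j : ℕ) then 1 else 0)
      + (if (j : ℕ) + 1 = (i : ℕ) then 1 else 0)
      + (if (i : ℕ) = 0 ∧ (j : ℕ) = p - 1 then w else 0)
      + (if (j : ℕ) = 0 ∧ (i : ℕ) = p - 1 then z else 0))
    {x : ℤ → ℂ} (hw : w * x (p - 1) = x (-1)) (hz : z * x 0 = x p) (i : Fin p) :
    (A.mulVec fun j => x (j : ℕ)) i = x ((i : ℕ) + 1) + x ((i : ℕ) - 1) + v i * x (i : ℕ) := by
  have hi := i.isLt
  have hdiag : ∑ j : Fin p, (if i = j then v i else 0) * x (j : ℕ) = v i * x (i : ℕ) := by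
    simp
  have hright : ∑ j : Fin p, (if (i : ℕ) + 1 = (j : ℕ) then (1 : ℂ) else 0) * x (j : ℕ)
      + ∑ j : Fin p, (if (j : ℕ) = 0 ∧ (i : ℕ) = p - 1 then z else 0) * x (j : ℕ)
      = x ((i : ℕ) + 1) := by
    by_cases h : (i : ℕ) + 1 < p
    · rw [Finset.sum_eq_single ⟨i + 1, h⟩, Finset.sum_eq_zero]
      · simp
      · intro j _
        rw [if_neg (by omega), zero_mul]
      · intro j _ hj
        rw [if_neg (fun h' => hj (Fin.ext h'.symm)), zero_mul]
      · simp
    · rw [Finset.sum_eq_zero, Finset.sum_eq_single ⟨0, by omega⟩]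
      · rw [if_pos ⟨rfl, by omega⟩, show ((i : ℕ) : ℤ) + 1 = p by omega, ← hz]
        simp
      · intro j _ hj
        rw [if_neg (fun h' => hj (Fin.ext h'.1)), zero_mul]
      · simp
      · intro j _
        rw [if_neg (by omega), zero_mul]
  have hleft : ∑ j : Fin p, (if (j : ℕ) + 1 = (i : ℕ) then (1 : ℂ) else 0) * x (j : ℕ)
      + ∑ j : Fin p, (if (i : ℕ) = 0 ∧ (j : ℕ) = p - 1 then w else 0) * x (j : ℕ)
      = x ((i : ℕ) - 1) := by
    by_cases h : 0 < (i : ℕ)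
    · rw [Finset.sum_eq_single ⟨i - 1, by omega⟩, Finset.sum_eq_zero]
      · rw [if_pos (by simp; omega)]
        simp [Nat.cast_sub h]
      · intro j _
        rw [if_neg (by omega), zero_mul]
      · intro j _ hj
        rw [if_neg (fun h' => hj (Fin.ext (by simp; omega))), zero_mul]
      · simp
    · rw [Finset.sum_eq_zero, Finset.sum_eq_single ⟨p - 1, by omega⟩]
      · rw [if_pos ⟨by omega, rfl⟩, show ((i : ℕ) : ℤ) - 1 = -1 by omega, ← hw]
        simp [Nat.cast_sub (show 1 ≤ p by omega)]
      · intro j _ hj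
        rw [if_neg (fun h' => hj (Fin.ext h'.2)), zero_mul]
      · simp
      · intro j _
        rw [if_neg (by omega), zero_mul]
  rw [← hright, ← hleft, ← hdiag]
  simp only [Matrix.mulVec, dotProduct, hA, add_mul, Finset.sum_add_distrib]
  ring

/-- The entries of a Bloch matrix over the period starting at `l` with Floquet multiplier `z`. -/
def IsBlochMatrix (V : ℤ → ℝ) (l : ℤ) (z : ℂ) (A : Matrix (Fin p) (Fin p) ℂ) : Prop :=
  ∀ i j : Fin p, A i j = (if i = j then (V (l + (i : ℕ)) : ℂ) else 0)
    + (if (i : ℕ) + 1 = (j : ℕ) then 1 else 0)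
    + (if (j : ℕ) + 1 = (i : ℕ) then 1 else 0)
    + (if (i : ℕ) = 0 ∧ (j : ℕ) = p - 1 then z⁻¹ else 0)
    + (if (j : ℕ) = 0 ∧ (i : ℕ) = p - 1 then z else 0)

variable {V : ℤ → ℝ} {l : ℤ} {z : ℂ} {A B : Matrix (Fin p) (Fin p) ℂ}

lemma IsBlochMatrix.blochExtend_mulVec (hA : IsBlochMatrix V l z A)
    (hV : ∀ n : ℤ, V (n + p) = V n) (hp : 0 < p) (hz : z ≠ 0) (u : Fin p → ℂ) (n : ℤ) :
    blochExtend hp z (A.mulVec u) n = blochExtend hp z u (n + 1) + blochExtend hp z u (n - 1)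
      + V (l + n) * blochExtend hp z u n := by
  have hper := blochExtend_add_period hp hz u
  have hu : u = fun j : Fin p => blochExtend hp z u (j : ℕ) :=
    funext fun j => (blochExtend_coe hp z u j).symm
  have key : A.mulVec u = fun i : Fin p => blochExtend hp z u ((i : ℕ) + 1)
      + blochExtend hp z u ((i : ℕ) - 1) + V (l + (i : ℕ)) * blochExtend hp z u (i : ℕ) := by
    ext i
    conv_lhs => rw [hu]
    refine mulVec_apply_eq (v := fun i : Fin p => (V (l + (i : ℕ)) : ℂ)) hA ?_ ?_ i
    · rw [show (p : ℤ) - 1 = -1 + p by ring, hper, inv_mul_cancel_left₀ hz]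
    · rw [← hper, zero_add]
  rw [key]
  refine (eq_blochExtend hp hz (x := fun n => blochExtend hp z u (n + 1)
    + blochExtend hp z u (n - 1) + V (l + n) * blochExtend hp z u n) (fun n => ?_) n).symm
  rw [add_right_comm n, add_sub_right_comm n, hper, hper, hper, ← add_assoc l, hV]
  ring

/-- Bloch matrices over consecutive windows are conjugate. -/
lemma IsBlochMatrix.charpoly_eq (hA : IsBlochMatrix V l z A) (hB : IsBlochMatrix V (l + 1) z B)
    (hV : ∀ n : ℤ, V (n + p) = V n) (hp : 0 < p) (hz : z ≠ 0) : B.charpoly = A.charpoly := by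
  have hconj : B.toLin' = (blochShiftEquiv hp hz).conj A.toLin' := by
    refine LinearMap.ext fun u => ?_
    obtain ⟨u, rfl⟩ := (blochShiftEquiv hp hz).surjective u
    rw [LinearEquiv.conj_apply_apply, LinearEquiv.symm_apply_apply]
    ext i
    change B.mulVec (blochShift hp z 1 u) i = blochShift hp z 1 (A.mulVec u) i
    rw [← blochExtend_coe hp z (B.mulVec _), hB.blochExtend_mulVec hV hp hz,
      blochExtend_blochShift hp hz, blochExtend_blochShift hp hz, blochExtend_blochShift hp hz]
    change _ = blochExtend hp z (A.mulVec u) _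
    rw [hA.blochExtend_mulVec hV hp hz, add_sub_right_comm, add_right_comm l, add_assoc l]
  rw [← Matrix.charpoly_toLin', hconj, LinearEquiv.charpoly_conj, Matrix.charpoly_toLin']

lemma mem_spectrum_iff_exists_mulVec (A : Matrix (Fin p) (Fin p) ℂ) (c : ℂ) :
    c ∈ spectrum ℂ A ↔ ∃ u ≠ 0, A.mulVec u = c • u := by
  rw [← Matrix.spectrum_toLin', ← Module.End.hasEigenvalue_iff_mem_spectrum]
  constructor
  · intro h
    obtain ⟨u, hu⟩ := h.exists_hasEigenvector
    exact ⟨u, hu.2, by simpa using hu.apply_eq_smul⟩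
  · rintro ⟨u, h0, hu⟩
    exact Module.End.hasEigenvalue_of_hasEigenvector
      (Module.End.hasEigenvector_iff.mpr
        ⟨Module.End.mem_eigenspace_iff.mpr (by simpa using hu), h0⟩)

lemma IsBlochMatrix.mem_spectrum {H : lp (fun _ : ℤ => ℝ) 2 →L[ℝ] lp (fun _ : ℤ => ℝ) 2}
    (hH : ∀ ψ : lp (fun _ : ℤ => ℝ) 2, ∀ n : ℤ,
      H ψ n = ψ (n + 1) + ψ (n - 1) + V n * ψ n)
    (hA : IsBlochMatrix V 0 z A) (hV : ∀ n : ℤ, V (n + p) = V n) (hp : 0 < p) (hz : ‖z‖ = 1)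
    {E : ℝ} (hE : (E : ℂ) ∈ spectrum ℂ A) : E ∈ spectrum ℝ H := by
  have hz0 : z ≠ 0 := norm_ne_zero_iff.mp (by simp [hz])
  obtain ⟨u, hu0, hu⟩ := (mem_spectrum_iff_exists_mulVec A E).mp hE
  set x := blochExtend hp z u with hx
  have hsol : ∀ n, x (n + 1) + x (n - 1) + V n * x n = E * x n := fun n => by
    have h := hA.blochExtend_mulVec hV hp hz0 u n
    rw [zero_add] at h
    rw [hx, ← h, hu]
    simp [blochExtend, mul_left_comm]
  obtain ⟨i, hi⟩ := Function.ne_iff.mp hu0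
  have hxi : x (i : ℕ) ≠ 0 := by rwa [hx, blochExtend_coe]
  have hb := norm_blochExtend_le hp hz u
  by_cases hre : (x (i : ℕ)).re = 0
  · refine mem_spectrum_of_bounded_solution hH (ψ := fun n => (x n).im)
      (fun n => (Complex.abs_im_le_norm _).trans (hb n))
      ⟨(i : ℕ), fun him => hxi (Complex.ext hre him)⟩ fun n => ?_
    simpa using congrArg Complex.im (hsol n)
  · refine mem_spectrum_of_bounded_solution hH (ψ := fun n => (x n).re)
      (fun n => (Complex.abs_re_le_norm _).trans (hb n)) ⟨(i : ℕ), hre⟩ fun n => ?_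
    simpa using congrArg Complex.re (hsol n)

lemma exists_transfer_eigenvector (hz : z ≠ 0) {E : ℝ}
    (hE : (((discriminant V p).eval E : ℝ) : ℂ) = z + z⁻¹) :
    ∃ v ≠ 0, ((transfer V 0 p).map (aeval (E : ℂ))).mulVec v = z • v := by
  set M := (transfer V 0 p).map (aeval (E : ℂ)) with hM
  have hdet : M 0 0 * M 1 1 - M 0 1 * M 1 0 = 1 := by
    have h := congrArg (aeval (E : ℂ)) (det_transfer V 0 p)
    rw [Matrix.det_fin_two] at h
    rwa [map_sub, map_mul, map_mul, map_one] at h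
  have htr : M 0 0 + M 1 1 = z + z⁻¹ := by
    rw [← hE, discriminant, Matrix.trace_fin_two, hM, Matrix.map_apply, Matrix.map_apply,
      ← map_add]
    exact aeval_algebraMap_apply_eq_algebraMap_eval E _
  have h0 : (M - z • 1).det = 0 := by
    rw [Matrix.det_fin_two]
    simp only [Matrix.sub_apply, Matrix.smul_apply, Matrix.one_apply, smul_eq_mul]
    norm_num
    linear_combination hdet - z * htr - mul_inv_cancel₀ hz
  obtain ⟨v, hv0, hv⟩ := Matrix.exists_mulVec_eq_zero_iff.mpr h0
  refine ⟨v, hv0, ?_⟩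
  rw [Matrix.sub_mulVec, sub_eq_zero] at hv
  rw [hv, Matrix.smul_mulVec, Matrix.one_mulVec]

lemma IsBlochMatrix.mem_spectrum_of_discriminant (hA : IsBlochMatrix V 0 z A) (hp : 0 < p)
    (hz : z ≠ 0) {E : ℝ} (hE : (((discriminant V p).eval E : ℝ) : ℂ) = z + z⁻¹) :
    (E : ℂ) ∈ spectrum ℂ A := by
  obtain ⟨v, hv0, hv⟩ := exists_transfer_eigenvector hz hE
  set y : ℕ → Fin 2 → ℂ := fun j => ((transfer V 0 j).map (aeval (E : ℂ))).mulVec v with hy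
  have y0 : y 0 = v := by
    simp only [hy, transfer]
    rw [Matrix.map_one _ (map_zero _) (map_one _), Matrix.one_mulVec]
  have ys1 : ∀ j, y (j + 1) 1 = y j 0 := fun j => by
    simp [hy, transfer_one_row]
  have ys0 : ∀ j : ℕ, y (j + 1) 0 = (E - V j) * y j 0 - y j 1 := fun j => by
    simp [hy, transfer_zero_row]
    ring
  have yp : y p = z • v := hv
  obtain ⟨q, rfl⟩ : ∃ q, p = q + 1 := ⟨p - 1, by omega⟩
  set x : ℤ → ℂ := fun n => y (n + 1).toNat 1 with hx
  have xn : ∀ n : ℕ, x n = y n 0 := fun n => by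
    rw [← ys1]; rfl
  have xm : x (-1) = v 1 := by simp [hx, y0]
  have x0 : x 0 = v 0 := by rw [← y0]; exact xn 0
  have xq : x ((q + 1 : ℕ) - 1) = z * v 1 := by
    push_cast
    rw [add_sub_cancel_right, xn, ← ys1, yp]; rfl
  have xp : x (q + 1 : ℕ) = z * v 0 := by rw [xn, yp]; rfl
  refine (mem_spectrum_iff_exists_mulVec A E).mpr ⟨fun i => x (i : ℕ), fun h => hv0 ?_, ?_⟩
  · have h0 : x 0 = 0 := congrFun h ⟨0, by omega⟩
    have hq : x q = 0 := congrFun h ⟨q, by omega⟩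
    push_cast at xq
    rw [add_sub_cancel_right, hq] at xq
    ext i
    fin_cases i
    · exact x0.symm.trans h0
    · exact (mul_eq_zero.mp xq.symm).resolve_left hz
  · ext i
    rw [mulVec_apply_eq (v := fun i : Fin (q + 1) => (V (0 + (i : ℕ)) : ℂ)) hA
      (by rw [xq, xm, inv_mul_cancel_left₀ hz]) (by rw [x0, xp])]
    have h1 : x ((i : ℕ) + 1) = (E - V (i : ℕ)) * y i 0 - y i 1 := by
      rw [← ys0, ← xn]; push_cast; rfl
    have h2 : x ((i : ℕ) - 1) = y i 1 := by simp [hx]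
    rw [h1, h2, xn, zero_add, Pi.smul_apply, xn, smul_eq_mul]
    ring

end Bloch

end PeriodicSchrodinger

/-- For `p ≥ 2` and a `p`-periodic potential `V : ℤ → ℝ`, let
`H` be the Schrödinger operator on `ℓ²(ℤ)` with potential `V`, and for `k ∈ ℝ`
and `l ∈ ℤ` let `A l k` be the `p × p` Hermitian matrix with diagonal entries
`V(l), …, V(l+p-1)`, entries `1` on the first sub- and superdiagonal, entry
`e^{-ikp}` in the upper-right corner and `e^{ikp}` in the lower-left corner
(entries on overlapping positions being added), and all other entries `0`.
Then the eigenvalues of `A l k` do not depend on `l`, and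
`σ(H) = ⋃_k {eigenvalues of A 0 k}`. -/
theorem statement14
    (p : ℕ) (hp : 2 ≤ p) (V : ℤ → ℝ) (hV : ∀ n : ℤ, V (n + p) = V n)
    (H : lp (fun _ : ℤ => ℝ) 2 →L[ℝ] lp (fun _ : ℤ => ℝ) 2)
    (hH : ∀ ψ : lp (fun _ : ℤ => ℝ) 2, ∀ n : ℤ,
        H ψ n = ψ (n + 1) + ψ (n - 1) + V n * ψ n)
    (A : ℤ → ℝ → Matrix (Fin p) (Fin p) ℂ)
    (hA : ∀ (l : ℤ) (k : ℝ), ∀ i j : Fin p,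
      A l k i j = (if i = j then (V (l + (i : ℕ)) : ℂ) else 0)
        + (if (i : ℕ) + 1 = (j : ℕ) then 1 else 0)
        + (if (j : ℕ) + 1 = (i : ℕ) then 1 else 0)
        + (if (i : ℕ) = 0 ∧ (j : ℕ) = p - 1 then
            Complex.exp (-(Complex.I * k * p)) else 0)
        + (if (j : ℕ) = 0 ∧ (i : ℕ) = p - 1 then
            Complex.exp (Complex.I * k * p) else 0)) :
    (∀ (l l' : ℤ) (k : ℝ), (A l k).charpoly = (A l' k).charpoly) ∧
    spectrum ℝ H = {E : ℝ | ∃ k : ℝ, (E : ℂ) ∈ spectrum ℂ (A 0 k)} := by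
  have hmul : ∀ k : ℝ, ‖Complex.exp (Complex.I * k * p)‖ = 1 := fun k => by
    rw [show Complex.I * k * p = ((k * p : ℝ) : ℂ) * Complex.I by push_cast; ring]
    exact Complex.norm_exp_ofReal_mul_I _
  have hp0 : 0 < p := by omega
  have hB : ∀ (l : ℤ) (k : ℝ), PeriodicSchrodinger.IsBlochMatrix V l
      (Complex.exp (Complex.I * k * p)) (A l k) := fun l k i j => by
    rw [hA, Complex.exp_neg]
  constructor
  · have hstep : ∀ (l : ℤ) (k : ℝ), (A (l + 1) k).charpoly = (A l k).charpoly := fun l k =>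
      (hB l k).charpoly_eq (hB (l + 1) k) hV hp0 (Complex.exp_ne_zero _)
    have hzero : ∀ (l : ℤ) (k : ℝ), (A l k).charpoly = (A 0 k).charpoly := fun l k => by
      induction l using Int.induction_on with
      | zero => rfl
      | succ l ih => rw [hstep, ih]
      | pred l ih => rw [← hstep, sub_add_cancel, ih]
    intro l l' k
    rw [hzero l, hzero l']
  · ext E
    constructor
    · intro hE
      have hd := abs_le.mp (PeriodicSchrodinger.abs_eval_discriminant_le_two hV hH hE)
      set d := (PeriodicSchrodinger.discriminant V p).eval E with hdef
      have hpC : (p : ℂ) ≠ 0 := by exact_mod_cast hp0.ne'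
      refine ⟨Real.arccos (d / 2) / p,
        (hB 0 _).mem_spectrum_of_discriminant hp0 (Complex.exp_ne_zero _) ?_⟩
      rw [← hdef, ← Complex.exp_neg]
      have hcos : d = 2 * Real.cos (Real.arccos (d / 2)) := by
        rw [Real.cos_arccos (by linarith) (by linarith)]; ring
      have harg : Complex.I * ((Real.arccos (d / 2) / p : ℝ) : ℂ) * p
          = (Real.arccos (d / 2) : ℂ) * Complex.I := by
        push_cast
        field_simp
      rw [harg, ← neg_mul, ← Complex.two_cos, ← Complex.ofReal_cos]
      exact_mod_cast hcos
    · rintro ⟨k, hk⟩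
      exact (hB 0 k).mem_spectrum hH hV hp0 (hmul k) hk
end
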